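/- arXiv:1903.02177 — 2 statements merged into one kernel-verified Lean document; each statement's English description precedes it below -/
import Mathlib

section
/- An algebra (A, +, ‾, ;, ⌣, 1') whose reduct (A, +, ‾) is a Boolean algebra is a weakly associative relation algebra if and only if there exist a set U, a symmetric and reflexive binary relation E ⊆ U×U, and an injective map F : A → {R : R ⊆ E} satisfying F(x+y) = F(x)∪F(y), F(‾x) = E∖F(x), F(x;y) = (F(x)|F(y))∩E, F(x⌣) = F(x)⁻¹∩E, and F(1') = Id_U∩E for all x, y ∈ A. (In the terminology of the paper: WA = S K, where K is the class of relativizations of full algebras of binary relations to symmetric-reflexive relations.) -/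
universe u

/-- Relational composition of binary relations. -/
def relComp {U : Type*} (R S : Set (U × U)) : Set (U × U) :=
  {p | ∃ w, (p.1, w) ∈ R ∧ (w, p.2) ∈ S}

/-- Inverse of a binary relation. -/
def relInv {U : Type*} (R : Set (U × U)) : Set (U × U) :=
  {p | (p.2, p.1) ∈ R}

/-- The identity relation. -/
def idRel' {U : Type*} : Set (U × U) :=
  {p | p.1 = p.2}

/-- The axioms of weakly associative relation algebras over a Boolean algebra. -/
structure IsWeaklyAssociative {A : Type u} [BooleanAlgebra A]
    (comp : A → A → A) (conv : A → A) (one' : A) : Prop where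
  weak_assoc (x : A) : comp (comp (x ⊓ one') ⊤) ⊤ = comp (x ⊓ one') ⊤
  sup_comp (x y z : A) : comp (x ⊔ y) z = comp x z ⊔ comp y z
  comp_one (x : A) : comp x one' = x
  conv_conv (x : A) : conv (conv x) = x
  conv_sup (x y : A) : conv (x ⊔ y) = conv x ⊔ conv y
  conv_comp (x y : A) : conv (comp x y) = comp (conv y) (conv x)
  tarski (x y : A) : comp (conv x) (comp x y)ᶜ ≤ yᶜ

/-- Ultrafilters of a Boolean algebra. -/
@[ext]
structure BoolUltrafilter (A : Type u) [BooleanAlgebra A] where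
  carrier : Set A
  sup_mem' (x y : A) : x ⊔ y ∈ carrier ↔ x ∈ carrier ∨ y ∈ carrier
  compl_mem' (x : A) : xᶜ ∈ carrier ↔ x ∉ carrier

namespace BoolUltrafilter

variable {A : Type u} [BooleanAlgebra A]

instance : Membership A (BoolUltrafilter A) := ⟨fun a x => x ∈ a.carrier⟩

variable {a b : BoolUltrafilter A} {x y : A}

theorem sup_mem : x ⊔ y ∈ a ↔ x ∈ a ∨ y ∈ a := a.sup_mem' x y

theorem compl_mem : xᶜ ∈ a ↔ x ∉ a := a.compl_mem' x

theorem mem_of_le (hxy : x ≤ y) (hx : x ∈ a) : y ∈ a := by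
  rw [← sup_eq_right.2 hxy]
  exact sup_mem.2 (.inl hx)

theorem top_mem : ⊤ ∈ a := by
  rw [← sup_compl_eq_top (x := (⊤ : A)), sup_mem, compl_mem]
  exact em _

theorem bot_notMem : ⊥ ∉ a := by
  rw [← compl_mem, compl_bot]
  exact top_mem

theorem inf_mem : x ⊓ y ∈ a ↔ x ∈ a ∧ y ∈ a := by
  rw [← compl_compl (x ⊓ y), compl_mem, compl_inf, sup_mem, compl_mem, compl_mem]
  tauto

theorem eq_of_subset (hab : ∀ x ∈ a, x ∈ b) : a = b := by
  refine BoolUltrafilter.ext (Set.ext fun x => ⟨hab x, fun hx => ?_⟩)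
  by_contra hxa
  exact compl_mem.1 (hab _ (compl_mem.2 hxa)) hx

theorem exists_mem_disjoint (J : Set A) (hbot : ⊥ ∈ J)
    (hsup : ∀ x ∈ J, ∀ y ∈ J, x ⊔ y ∈ J) (hle : ∀ x y, x ≤ y → y ∈ J → x ∈ J)
    (hx : x ∉ J) : ∃ a : BoolUltrafilter A, x ∈ a ∧ ∀ y ∈ J, y ∉ a := by
  have hJ : Order.IsIdeal J := ⟨fun y z hzy hy => hle z y hzy hy, ⟨⊥, hbot⟩,
    fun y hy z hz => ⟨y ⊔ z, hsup y hy z hz, le_sup_left, le_sup_right⟩⟩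
  have hdisj : Disjoint (Order.PFilter.principal x : Set A) (hJ.toIdeal : Set A) := by
    rw [Set.disjoint_left]
    exact fun y hxy hy => hx (hle x y hxy hy)
  obtain ⟨I, hI, hJI, hxI⟩ := DistribLattice.prime_ideal_of_disjoint_filter_ideal hdisj
  have mem_compl (y : A) : yᶜ ∈ I ↔ y ∉ I := by
    constructor
    · intro hy' hy
      apply hI.toIsProper.top_notMem
      rw [← sup_compl_eq_top (x := y)]
      exact Order.Ideal.sup_mem hy hy'
    · exact hI.compl_mem_of_notMem
  refine ⟨⟨{y | y ∉ I}, fun y z => ?_, fun y => ?_⟩, ?_, ?_⟩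
  · simp only [Set.mem_ofPred_eq, Order.Ideal.sup_mem_iff]
    tauto
  · simp [mem_compl]
  · exact Set.disjoint_left.1 hxI (Order.PFilter.mem_principal.2 le_rfl)
  · exact fun y hy hy' => hy' (hJI hy)

end BoolUltrafilter

namespace IsWeaklyAssociative

variable {A : Type u} [BooleanAlgebra A] {comp : A → A → A} {conv : A → A} {one' : A}
  (h : IsWeaklyAssociative comp conv one')

include h

theorem conv_mono {x y : A} (hxy : x ≤ y) : conv x ≤ conv y := by
  rw [← sup_eq_right.2 hxy, h.conv_sup]
  exact le_sup_left

theorem conv_le_iff {x y : A} : conv x ≤ y ↔ x ≤ conv y :=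
  ⟨fun hxy => h.conv_conv x ▸ h.conv_mono hxy, fun hxy => h.conv_conv y ▸ h.conv_mono hxy⟩

theorem conv_top : conv ⊤ = ⊤ := top_le_iff.1 (h.conv_le_iff.1 le_top)

theorem conv_bot : conv ⊥ = ⊥ := le_bot_iff.1 (h.conv_le_iff.2 bot_le)

theorem conv_inf (x y : A) : conv (x ⊓ y) = conv x ⊓ conv y := by
  apply le_antisymm (le_inf (h.conv_mono inf_le_left) (h.conv_mono inf_le_right))
  rw [← h.conv_le_iff]
  exact le_inf (h.conv_le_iff.2 inf_le_left) (h.conv_le_iff.2 inf_le_right)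

theorem conv_compl (x : A) : conv xᶜ = (conv x)ᶜ := by
  refine (IsCompl.compl_eq (IsCompl.of_eq ?_ ?_)).symm
  · rw [← h.conv_inf, inf_compl_eq_bot, h.conv_bot]
  · rw [← h.conv_sup, sup_compl_eq_top, h.conv_top]

theorem comp_sup (x y z : A) : comp x (y ⊔ z) = comp x y ⊔ comp x z := by
  rw [← h.conv_conv (comp x (y ⊔ z)), h.conv_comp, h.conv_sup, h.sup_comp, h.conv_sup,
    ← h.conv_comp, ← h.conv_comp, h.conv_conv, h.conv_conv]

theorem comp_mono {x x' y y' : A} (hx : x ≤ x') (hy : y ≤ y') : comp x y ≤ comp x' y' := by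
  rw [← sup_eq_right.2 hx, ← sup_eq_right.2 hy, h.sup_comp, h.comp_sup]
  exact le_sup_left.trans le_sup_left

theorem conv_one : conv one' = one' := by
  have key : conv (comp (conv one') one') = comp (conv one') one' := by
    rw [h.conv_comp, h.conv_conv]
  rw [h.comp_one, h.conv_conv] at key
  exact key.symm

theorem one_comp (x : A) : comp one' x = x := by
  rw [← h.conv_conv (comp one' x), h.conv_comp, h.conv_one, h.comp_one, h.conv_conv]

theorem comp_bot (x : A) : comp x ⊥ = ⊥ := by
  have := h.tarski (conv x) ⊤
  rw [h.conv_conv, compl_top] at this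
  exact le_bot_iff.1 ((h.comp_mono le_rfl bot_le).trans this)

theorem bot_comp (x : A) : comp ⊥ x = ⊥ := by
  rw [← h.conv_conv (comp ⊥ x), h.conv_comp, h.conv_bot, h.comp_bot, h.conv_bot]

theorem disjoint_comp_left {x y z : A} (hd : Disjoint (comp (conv x) z) y) :
    Disjoint (comp x y) z := by
  have hle : y ≤ (comp (conv x) z)ᶜ := le_compl_iff_disjoint_right.2 hd.symm
  have := h.tarski (conv x) z
  rw [h.conv_conv] at this
  exact le_compl_iff_disjoint_right.1 ((h.comp_mono le_rfl hle).trans this)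

theorem disjoint_conv {x y : A} (hd : Disjoint (conv x) (conv y)) : Disjoint x y := by
  rw [disjoint_iff] at hd ⊢
  rw [← h.conv_conv (x ⊓ y), h.conv_inf, hd, h.conv_bot]

theorem disjoint_comp_right {x y z : A} (hd : Disjoint (comp z (conv y)) x) :
    Disjoint (comp x y) z := by
  apply h.disjoint_conv
  rw [h.conv_comp]
  apply h.disjoint_comp_left
  rw [← h.conv_comp]
  apply h.disjoint_conv
  rwa [h.conv_conv, h.conv_conv]

theorem comp_le_inf {p q : A} (hp : p ≤ one') (hq : q ≤ one') : comp p q ≤ p ⊓ q :=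
  le_inf ((h.comp_mono le_rfl hq).trans_eq (h.comp_one p))
    ((h.comp_mono hp le_rfl).trans_eq (h.one_comp q))

theorem conv_of_le_one {q : A} (hq : q ≤ one') : conv q = q := by
  have key {q : A} (hq : q ≤ one') : conv q ≤ q := by
    have hbot : comp q (one' ⊓ qᶜ) = ⊥ := by
      refine le_bot_iff.1 ((h.comp_le_inf hq inf_le_left).trans ?_)
      rw [inf_left_comm, inf_compl_eq_bot, inf_bot_eq]
    have ht := h.tarski q (one' ⊓ qᶜ)
    rw [hbot, compl_bot, compl_inf, compl_compl] at ht
    have hle : conv q ≤ one'ᶜ ⊔ q :=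
      (h.comp_one (conv q)).symm.le.trans ((h.comp_mono le_rfl le_top).trans ht)
    have hone : conv q ≤ one' := (h.conv_mono hq).trans_eq h.conv_one
    calc conv q ≤ one' ⊓ (one'ᶜ ⊔ q) := le_inf hone hle
      _ = one' ⊓ q := by rw [inf_sup_left, inf_compl_eq_bot, bot_sup_eq]
      _ ≤ q := inf_le_right
  exact le_antisymm (key hq) (h.conv_le_iff.1 (key hq))

theorem top_comp_top_comp {p : A} (hp : p ≤ one') : comp ⊤ (comp ⊤ p) = comp ⊤ p := by
  have hw := congrArg conv (h.weak_assoc p)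
  rwa [inf_eq_left.2 hp, h.conv_comp, h.conv_comp, h.conv_top, h.conv_of_le_one hp] at hw

theorem disjoint_top_comp {p q : A} (hp : p ≤ one') (hq : q ≤ one') (hpq : Disjoint p q) :
    Disjoint (comp ⊤ p) (comp ⊤ q) := by
  apply h.disjoint_comp_left
  rw [h.conv_top, h.top_comp_top_comp hq]
  apply h.disjoint_comp_right
  rw [h.conv_of_le_one hq, disjoint_top]
  exact le_bot_iff.1 ((h.comp_le_inf hp hq).trans_eq hpq.eq_bot)

open BoolUltrafilter

/-- The converse of an ultrafilter. -/
def cv (a : BoolUltrafilter A) : BoolUltrafilter A where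
  carrier := {x | conv x ∈ a}
  sup_mem' x y := by simp only [Set.mem_ofPred_eq, h.conv_sup, sup_mem]
  compl_mem' x := by simp only [Set.mem_ofPred_eq, h.conv_compl, compl_mem]

theorem mem_cv {a : BoolUltrafilter A} {x : A} : x ∈ h.cv a ↔ conv x ∈ a := Iff.rfl

theorem cv_cv (a : BoolUltrafilter A) : h.cv (h.cv a) = a :=
  eq_of_subset fun x hx => by rwa [mem_cv, mem_cv, h.conv_conv] at hx

/-- The identity ultrafilter at the right end of an ultrafilter. -/
def tgt (a : BoolUltrafilter A) : BoolUltrafilter A where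
  carrier := {p | comp ⊤ (p ⊓ one') ∈ a}
  sup_mem' x y := by simp only [Set.mem_ofPred_eq, inf_sup_right, h.comp_sup, sup_mem]
  compl_mem' x := by
    have hd : comp ⊤ (x ⊓ one') ⊓ comp ⊤ (xᶜ ⊓ one') = ⊥ :=
      (h.disjoint_top_comp inf_le_right inf_le_right
        (disjoint_compl_right.mono inf_le_left inf_le_left)).eq_bot
    have ht : comp ⊤ (x ⊓ one') ⊔ comp ⊤ (xᶜ ⊓ one') = ⊤ := by
      rw [← h.comp_sup, ← inf_sup_right, sup_compl_eq_top, top_inf_eq, h.comp_one]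
    have hd' := hd ▸ bot_notMem (a := a)
    have ht' := ht ▸ top_mem (a := a)
    rw [inf_mem] at hd'
    rw [sup_mem] at ht'
    simp only [Set.mem_ofPred_eq]
    change _ ∈ a ↔ ¬ _ ∈ a
    tauto

theorem mem_tgt {a : BoolUltrafilter A} {x : A} : x ∈ h.tgt a ↔ comp ⊤ (x ⊓ one') ∈ a := Iff.rfl

/-- The composition relation on ultrafilters. -/
def Tri (_ : IsWeaklyAssociative comp conv one') (a b c : BoolUltrafilter A) : Prop :=
  ∀ x ∈ a, ∀ y ∈ b, comp x y ∈ c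

theorem exists_tri {c : BoolUltrafilter A} {x y : A} (hc : comp x y ∈ c) :
    ∃ a b, h.Tri a b c ∧ x ∈ a ∧ y ∈ b := by
  obtain ⟨a, hxa, ha⟩ := exists_mem_disjoint (x := x) {z | comp z y ∉ c}
    (by simpa [h.bot_comp] using bot_notMem)
    (fun z hz w hw => by simpa [h.sup_comp, sup_mem] using And.intro hz hw)
    (fun z w hzw hw hz => hw (mem_of_le (h.comp_mono hzw le_rfl) hz)) (by simpa using hc)
  obtain ⟨b, hyb, hb⟩ := exists_mem_disjoint (x := y) {z | ∃ w ∈ a, comp w z ∉ c}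
    ⟨⊤, top_mem, by simpa [h.comp_bot] using bot_notMem⟩
    (fun z ⟨w, hw, hz⟩ z' ⟨w', hw', hz'⟩ => ⟨w ⊓ w', inf_mem.2 ⟨hw, hw'⟩, by
      rw [h.comp_sup, sup_mem]
      rintro (hm | hm)
      · exact hz (mem_of_le (h.comp_mono inf_le_left le_rfl) hm)
      · exact hz' (mem_of_le (h.comp_mono inf_le_right le_rfl) hm)⟩)
    (fun z z' hzz' ⟨w, hw, hz'⟩ =>
      ⟨w, hw, fun hz => hz' (mem_of_le (h.comp_mono le_rfl hzz') hz)⟩)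
    (fun ⟨w, hw, hwy⟩ => ha w hwy hw)
  refine ⟨a, b, fun z hz w hw => ?_, hxa, hyb⟩
  by_contra hzw
  exact hb w ⟨z, hz, hzw⟩ hw

section Triangles

variable {a b c i : BoolUltrafilter A}

variable {h} in
theorem Tri.rotate (t : h.Tri a b c) : h.Tri (h.cv a) c b := by
  intro x hx z hz
  by_contra hxz
  have := mem_of_le (h.tarski x z) (t _ hx _ (compl_mem.2 hxz))
  exact compl_mem.1 this hz

variable {h} in
theorem Tri.cv (t : h.Tri a b c) : h.Tri (h.cv b) (h.cv a) (h.cv c) := by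
  intro x hx y hy
  rw [mem_cv, h.conv_comp]
  exact t _ hy _ hx

variable {h} in
theorem Tri.rotate' (t : h.Tri a b c) : h.Tri c (h.cv b) a := by
  simpa only [cv_cv] using t.rotate.cv.rotate

variable {h} in
theorem Tri.tgt_eq (t : h.Tri a b c) : h.tgt c = h.tgt b := by
  refine (eq_of_subset fun p hp => ?_).symm
  rw [mem_tgt, ← h.top_comp_top_comp inf_le_right]
  exact t _ top_mem _ hp

variable {h} in
theorem Tri.src_eq (t : h.Tri a b c) : h.tgt (h.cv c) = h.tgt (h.cv a) := t.cv.tgt_eq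

variable {h} in
theorem Tri.mid_eq (t : h.Tri a b c) : h.tgt (h.cv b) = h.tgt a := t.rotate'.tgt_eq.symm

theorem one_mem_tgt : one' ∈ h.tgt a := by
  rw [mem_tgt, inf_idem, h.comp_one]
  exact top_mem

theorem one_mem_cv : one' ∈ h.cv a ↔ one' ∈ a := by rw [mem_cv, h.conv_one]

theorem tgt_eq_self (hi : one' ∈ i) : h.tgt i = i := by
  refine (eq_of_subset fun p hp => ?_).symm
  rw [mem_tgt]
  refine mem_of_le (h.comp_mono (le_top (a := one')) le_rfl) ?_
  rw [h.one_comp]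
  exact inf_mem.2 ⟨hp, hi⟩

theorem cv_eq_self (hi : one' ∈ i) : h.cv i = i := by
  refine (eq_of_subset fun p hp => ?_).symm
  rw [mem_cv]
  refine mem_of_le (h.conv_mono (inf_le_left (b := one'))) ?_
  rw [h.conv_of_le_one inf_le_right]
  exact inf_mem.2 ⟨hp, hi⟩

variable {h} in
theorem Tri.eq_of_right (t : h.Tri a i c) (hi : one' ∈ i) : a = c :=
  eq_of_subset fun x hx => h.comp_one x ▸ t x hx _ hi

variable {h} in
theorem Tri.eq_of_left (t : h.Tri i b c) (hi : one' ∈ i) : b = c :=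
  eq_of_subset fun x hx => h.one_comp x ▸ t _ hi x hx

variable {h} in
theorem Tri.eq_cv (t : h.Tri a b i) (hi : one' ∈ i) : h.cv a = b := t.rotate.eq_of_right hi

theorem tri_tgt (a : BoolUltrafilter A) : h.Tri a (h.tgt a) a := by
  intro x hx p hp
  have hx' : comp x (p ⊓ one') ⊔ comp x (pᶜ ⊓ one') ∈ a := by
    rwa [← h.comp_sup, ← inf_sup_right, sup_compl_eq_top, top_inf_eq, h.comp_one]
  rcases sup_mem.1 hx' with hx' | hx'
  · exact mem_of_le (h.comp_mono le_rfl inf_le_left) hx'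
  · have : pᶜ ∈ h.tgt a :=
      h.mem_tgt.2 (mem_of_le (h.comp_mono le_top le_rfl) hx')
    exact absurd hp (compl_mem.1 this)

theorem tri_src (a : BoolUltrafilter A) : h.Tri (h.tgt (h.cv a)) a a := by
  simpa only [cv_cv, h.cv_eq_self h.one_mem_tgt] using (h.tri_tgt (h.cv a)).cv

theorem tri_cv (a : BoolUltrafilter A) : h.Tri a (h.cv a) (h.tgt (h.cv a)) := by
  simpa only [cv_cv] using (h.tri_tgt (h.cv a)).rotate

end Triangles

/-- Formal points: `node u v a b` is a free witness that an edge from `u` to `v` is below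
the composition of `a` and `b`. -/
inductive Point (A : Type u) [BooleanAlgebra A] : Type u
  | root (i : BoolUltrafilter A) : Point A
  | node (u v : Point A) (a b : BoolUltrafilter A) : Point A

open Point

/-- The identity ultrafilter labelling the loop at a point. -/
def loop : Point A → BoolUltrafilter A
  | root i => i
  | node _ _ a _ => h.tgt a

/-- The labelled edges of the free representation. -/
inductive Edge : Point A → Point A → BoolUltrafilter A → Prop
  | root (i) (hi : one' ∈ i) : Edge (root i) (root i) i
  | node {u v : Point A} {a b c : BoolUltrafilter A} (hc : Edge u v c) (t : h.Tri a b c)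
      (ha : one' ∉ a) (hb : one' ∉ b) : Edge (node u v a b) (node u v a b) (h.tgt a)
  | left {u v : Point A} {a b c : BoolUltrafilter A} (hc : Edge u v c) (t : h.Tri a b c)
      (ha : one' ∉ a) (hb : one' ∉ b) : Edge u (node u v a b) a
  | left_cv {u v : Point A} {a b c : BoolUltrafilter A} (hc : Edge u v c) (t : h.Tri a b c)
      (ha : one' ∉ a) (hb : one' ∉ b) : Edge (node u v a b) u (h.cv a)
  | right {u v : Point A} {a b c : BoolUltrafilter A} (hc : Edge u v c) (t : h.Tri a b c)
      (ha : one' ∉ a) (hb : one' ∉ b) : Edge (node u v a b) v b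
  | right_cv {u v : Point A} {a b c : BoolUltrafilter A} (hc : Edge u v c) (t : h.Tri a b c)
      (ha : one' ∉ a) (hb : one' ∉ b) : Edge v (node u v a b) (h.cv b)

/-- The edges from a node to the two points it was added for. -/
def Down (x y : Point A) (d : BoolUltrafilter A) : Prop :=
  ∃ u v a b c, x = node u v a b ∧ h.Edge u v c ∧ h.Tri a b c ∧ one' ∉ a ∧ one' ∉ b ∧
    (y = u ∧ d = h.cv a ∨ y = v ∧ d = b)

section Edges

variable {x y z : Point A} {a b c d : BoolUltrafilter A}

variable {h} in
theorem Edge.cv (e : h.Edge x y a) : h.Edge y x (h.cv a) := by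
  cases e with
  | root i hi => rw [h.cv_eq_self hi]; exact .root _ hi
  | node hc t ha hb => rw [h.cv_eq_self h.one_mem_tgt]; exact .node hc t ha hb
  | left hc t ha hb => exact .left_cv hc t ha hb
  | left_cv hc t ha hb => rw [cv_cv]; exact .left hc t ha hb
  | right hc t ha hb => exact .right_cv hc t ha hb
  | right_cv hc t ha hb => rw [cv_cv]; exact .right hc t ha hb

variable {h} in
theorem Edge.tgt_eq_loop (e : h.Edge x y a) : h.tgt a = h.loop y ∧ h.tgt (h.cv a) = h.loop x := by
  induction e with
  | root i hi => rw [h.cv_eq_self hi, h.tgt_eq_self hi]; exact ⟨rfl, rfl⟩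
  | node hc t ha hb ih =>
    rw [h.cv_eq_self h.one_mem_tgt, h.tgt_eq_self h.one_mem_tgt]; exact ⟨rfl, rfl⟩
  | left hc t ha hb ih => exact ⟨rfl, t.src_eq.symm.trans ih.2⟩
  | left_cv hc t ha hb ih => rw [cv_cv]; exact ⟨t.src_eq.symm.trans ih.2, rfl⟩
  | right hc t ha hb ih => exact ⟨t.tgt_eq.symm.trans ih.1, t.mid_eq⟩
  | right_cv hc t ha hb ih => rw [cv_cv]; exact ⟨t.mid_eq, t.tgt_eq.symm.trans ih.1⟩

variable {h} in
theorem Edge.loop_edge (e : h.Edge x y a) :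
    h.Edge x x (h.loop x) ∧ h.Edge y y (h.loop y) := by
  induction e with
  | root i hi => exact ⟨.root _ hi, .root _ hi⟩
  | node hc t ha hb ih => exact ⟨.node hc t ha hb, .node hc t ha hb⟩
  | left hc t ha hb ih => exact ⟨ih.1, .node hc t ha hb⟩
  | left_cv hc t ha hb ih => exact ⟨.node hc t ha hb, ih.1⟩
  | right hc t ha hb ih => exact ⟨.node hc t ha hb, ih.2⟩
  | right_cv hc t ha hb ih => exact ⟨ih.2, .node hc t ha hb⟩

variable {h} in
theorem Down.sizeOf_lt (e : h.Down x y d) : sizeOf y < sizeOf x := by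
  obtain ⟨u, v, a, b, c, rfl, -, -, -, -, ⟨rfl, -⟩ | ⟨rfl, -⟩⟩ := e <;> simp <;> omega

variable {h} in
theorem Down.one_notMem (e : h.Down x y d) : one' ∉ d := by
  obtain ⟨u, v, a, b, c, rfl, -, -, ha, hb, ⟨-, rfl⟩ | ⟨-, rfl⟩⟩ := e
  · rwa [h.one_mem_cv]
  · exact hb

variable {h} in
theorem Edge.cases_down (e : h.Edge x y d) :
    (x = y ∧ one' ∈ d) ∨ h.Down x y d ∨ h.Down y x (h.cv d) := by
  cases e with
  | root i hi => exact .inl ⟨rfl, hi⟩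
  | node hc t ha hb => exact .inl ⟨rfl, h.one_mem_tgt⟩
  | left hc t ha hb => exact .inr (.inr ⟨_, _, _, _, _, rfl, hc, t, ha, hb, .inl ⟨rfl, rfl⟩⟩)
  | left_cv hc t ha hb => exact .inr (.inl ⟨_, _, _, _, _, rfl, hc, t, ha, hb, .inl ⟨rfl, rfl⟩⟩)
  | right hc t ha hb => exact .inr (.inl ⟨_, _, _, _, _, rfl, hc, t, ha, hb, .inr ⟨rfl, rfl⟩⟩)
  | right_cv hc t ha hb =>
    exact .inr (.inr ⟨_, _, _, _, _, rfl, hc, t, ha, hb, .inr ⟨rfl, h.cv_cv _⟩⟩)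

variable {h} in
theorem Edge.one_mem_iff (e : h.Edge x y d) : one' ∈ d ↔ x = y := by
  rcases e.cases_down with ⟨hxy, hd⟩ | e | e
  · exact iff_of_true hd hxy
  · exact iff_of_false e.one_notMem fun hxy => (hxy ▸ e.sizeOf_lt).false
  · exact iff_of_false (fun hd => e.one_notMem (h.one_mem_cv.2 hd))
      fun hxy => (hxy ▸ e.sizeOf_lt).false

variable {h} in
theorem Edge.eq_loop (e : h.Edge x x d) : d = h.loop x := by
  rw [← e.tgt_eq_loop.1, h.tgt_eq_self (e.one_mem_iff.2 rfl)]

variable {h} in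
theorem Down.unique (e : h.Down x y c) (e' : h.Down x y d) : c = d := by
  obtain ⟨u, v, a, b, f, rfl, hf, t, -, -, hy⟩ := e
  obtain ⟨u', v', a', b', f', hx, -, -, -, -, hy'⟩ := e'
  obtain ⟨rfl, rfl, rfl, rfl⟩ := Point.node.inj hx
  have key (huv : u = v) : h.cv a = b := t.eq_cv (hf.one_mem_iff.2 huv)
  rcases hy with ⟨rfl, rfl⟩ | ⟨rfl, rfl⟩ <;> rcases hy' with ⟨hu, rfl⟩ | ⟨hu, rfl⟩
  · rfl
  · exact key hu
  · exact (key hu.symm).symm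
  · rfl

variable {h} in
theorem Edge.unique (e : h.Edge x y c) (e' : h.Edge x y d) : c = d := by
  rcases e.cases_down with ⟨rfl, -⟩ | hc | hc
  · rw [e.eq_loop, e'.eq_loop]
  all_goals rcases e'.cases_down with ⟨rfl, -⟩ | hd | hd
  · exact absurd hc.sizeOf_lt (lt_irrefl _)
  · exact hc.unique hd
  · exact absurd hc.sizeOf_lt hd.sizeOf_lt.asymm
  · exact absurd hc.sizeOf_lt (lt_irrefl _)
  · exact absurd hc.sizeOf_lt hd.sizeOf_lt.asymm
  · rw [← h.cv_cv c, hc.unique hd, cv_cv]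

variable {h} in
theorem Down.tri (hyz : y ≠ z) (ea : h.Down x y a) (eb : h.Edge y z b) (ec : h.Down x z c) :
    h.Tri a b c := by
  obtain ⟨u, v, a₀, b₀, c₀, rfl, hc₀, t, -, -, hy⟩ := ea
  obtain ⟨u', v', a', b', c', hx, -, -, -, -, hz⟩ := ec
  obtain ⟨rfl, rfl, rfl, rfl⟩ := Point.node.inj hx
  rcases hy with ⟨rfl, rfl⟩ | ⟨rfl, rfl⟩ <;> rcases hz with ⟨rfl, rfl⟩ | ⟨rfl, rfl⟩
  · exact absurd rfl hyz
  · rw [eb.unique hc₀]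
    exact t.rotate
  · rw [eb.unique hc₀.cv]
    simpa only [cv_cv] using t.rotate'.cv
  · exact absurd rfl hyz

variable {h} in
theorem Edge.tri (ea : h.Edge x y a) (eb : h.Edge y z b) (ec : h.Edge x z c) :
    h.Tri a b c := by
  by_cases hxy : x = y
  · subst hxy
    rw [ea.eq_loop, ← eb.unique ec, ← eb.tgt_eq_loop.2]
    exact h.tri_src b
  by_cases hyz : y = z
  · subst hyz
    rw [eb.eq_loop, ← ea.unique ec, ← ea.tgt_eq_loop.1]
    exact h.tri_tgt a
  by_cases hxz : x = z
  · subst hxz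
    rw [ec.eq_loop, eb.unique ea.cv, ← ea.tgt_eq_loop.2]
    exact h.tri_cv a
  have ha := ea.cases_down.resolve_left fun hd => hxy hd.1
  have hb := eb.cases_down.resolve_left fun hd => hyz hd.1
  have hc := ec.cases_down.resolve_left fun hd => hxz hd.1
  have top_x (ha : h.Down x y a) (hc : h.Down x z c) : h.Tri a b c := ha.tri hyz eb hc
  have top_y (ha : h.Down y x (h.cv a)) (hb : h.Down y z b) : h.Tri a b c := by
    simpa only [cv_cv] using (ha.tri hxz ec hb).rotate
  have top_z (hb : h.Down z y (h.cv b)) (hc : h.Down z x (h.cv c)) : h.Tri a b c := by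
    simpa only [cv_cv] using (hb.tri (Ne.symm hxy) ea.cv hc).cv
  rcases ha with ha | ha <;> rcases hb with hb | hb <;> rcases hc with hc | hc
  · exact top_x ha hc
  · exact absurd (hb.sizeOf_lt.trans ha.sizeOf_lt) hc.sizeOf_lt.asymm
  · exact top_x ha hc
  · exact top_z hb hc
  · exact top_y ha hb
  · exact top_y ha hb
  · exact absurd (ha.sizeOf_lt.trans hb.sizeOf_lt) hc.sizeOf_lt.asymm
  · exact top_z hb hc

variable {h} in
theorem Edge.exists_witness (e : h.Edge x y c) (t : h.Tri a b c) :
    ∃ w, h.Edge x w a ∧ h.Edge w y b := by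
  by_cases ha : one' ∈ a
  · obtain rfl := t.eq_of_left ha
    have hax : a = h.loop x := by
      rw [← e.tgt_eq_loop.2, t.src_eq, h.cv_eq_self ha, h.tgt_eq_self ha]
    exact ⟨x, hax ▸ e.loop_edge.1, e⟩
  by_cases hb : one' ∈ b
  · obtain rfl := t.eq_of_right hb
    have hby : b = h.loop y := by
      rw [← e.tgt_eq_loop.1, t.tgt_eq, h.tgt_eq_self hb]
    exact ⟨y, e, hby ▸ e.loop_edge.2⟩
  exact ⟨Point.node x y a b, .left e t ha hb, .right e t ha hb⟩

theorem exists_edge (a : BoolUltrafilter A) : ∃ x y, h.Edge x y a := by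
  obtain ⟨w, hw, -⟩ := (Edge.root _ (h.one_mem_tgt (a := h.cv a))).exists_witness (h.tri_cv a)
  exact ⟨_, w, hw⟩

end Edges

theorem exists_representation : ∃ (U : Type u) (E : Set (U × U)),
    (∀ u v : U, (u, v) ∈ E → (v, u) ∈ E) ∧
    (∀ u v : U, (u, v) ∈ E → (u, u) ∈ E ∧ (v, v) ∈ E) ∧
    ∃ F : A → Set (U × U),
      Function.Injective F ∧
      (∀ x : A, F x ⊆ E) ∧
      (∀ x y : A, F (x ⊔ y) = F x ∪ F y) ∧
      (∀ x : A, F xᶜ = E \ F x) ∧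
      (∀ x y : A, F (comp x y) = relComp (F x) (F y) ∩ E) ∧
      (∀ x : A, F (conv x) = relInv (F x) ∩ E) ∧
      F one' = idRel' ∩ E := by
  refine ⟨Point A, {p | ∃ a, h.Edge p.1 p.2 a}, fun u v ⟨a, e⟩ => ⟨_, e.cv⟩,
    fun u v ⟨a, e⟩ => ⟨⟨_, e.loop_edge.1⟩, ⟨_, e.loop_edge.2⟩⟩,
    fun x => {p | ∃ a, h.Edge p.1 p.2 a ∧ x ∈ a}, ?_, ?_, ?_, ?_, ?_, ?_, ?_⟩
  · have key {x y : A}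
        (hxy : {p : Point A × Point A | ∃ a, h.Edge p.1 p.2 a ∧ x ∈ a} ⊆
          {p | ∃ a, h.Edge p.1 p.2 a ∧ y ∈ a}) : x ≤ y := by
      by_contra hle
      obtain ⟨a, hxa, ha⟩ := exists_mem_disjoint (Set.Iic y) bot_le
        (fun _ hz _ hw => sup_le hz hw) (fun _ _ hzw hw => le_trans hzw hw) hle
      obtain ⟨u, v, e⟩ := h.exists_edge a
      obtain ⟨b, e', hyb⟩ := hxy (show (u, v) ∈ _ from ⟨a, e, hxa⟩)
      exact ha y le_rfl (e'.unique e ▸ hyb)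
    exact fun x y hxy => le_antisymm (key hxy.subset) (key hxy.symm.subset)
  · exact fun x p ⟨a, e, _⟩ => ⟨a, e⟩
  · intro x y
    ext p
    simp only [sup_mem, Set.mem_ofPred_eq, Set.mem_union]
    grind
  · intro x
    ext p
    constructor
    · rintro ⟨a, e, ha⟩
      exact ⟨⟨a, e⟩, fun ⟨b, e', hb⟩ => compl_mem.1 ha (e'.unique e ▸ hb)⟩
    · rintro ⟨⟨a, e⟩, ha⟩
      exact ⟨a, e, compl_mem.2 fun hx => ha ⟨a, e, hx⟩⟩
  · intro x y
    ext p
    constructor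
    · rintro ⟨c, e, hc⟩
      obtain ⟨a, b, t, ha, hb⟩ := h.exists_tri hc
      obtain ⟨w, ea, eb⟩ := e.exists_witness t
      exact ⟨⟨w, ⟨a, ea, ha⟩, ⟨b, eb, hb⟩⟩, ⟨c, e⟩⟩
    · rintro ⟨⟨w, ⟨a, ea, ha⟩, ⟨b, eb, hb⟩⟩, ⟨c, e⟩⟩
      exact ⟨c, e, ea.tri eb e x ha y hb⟩
  · intro x
    ext p
    constructor
    · rintro ⟨a, e, ha⟩
      exact ⟨⟨_, e.cv, ha⟩, ⟨a, e⟩⟩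
    · rintro ⟨⟨a, e, ha⟩, -⟩
      refine ⟨_, e.cv, ?_⟩
      rwa [mem_cv, h.conv_conv]
  · ext p
    constructor
    · rintro ⟨a, e, ha⟩
      exact ⟨e.one_mem_iff.1 ha, ⟨a, e⟩⟩
    · rintro ⟨hp, ⟨a, e⟩⟩
      exact ⟨a, e, e.one_mem_iff.2 hp⟩

end IsWeaklyAssociative

theorem isWeaklyAssociative_of_representation {A : Type u} [BooleanAlgebra A]
    {comp : A → A → A} {conv : A → A} {one' : A} {U : Type u} {E : Set (U × U)}
    (symm : ∀ u v : U, (u, v) ∈ E → (v, u) ∈ E)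
    (refl : ∀ u v : U, (u, v) ∈ E → (u, u) ∈ E ∧ (v, v) ∈ E)
    {F : A → Set (U × U)} (inj : Function.Injective F) (sub : ∀ x : A, F x ⊆ E)
    (map_sup : ∀ x y : A, F (x ⊔ y) = F x ∪ F y)
    (map_compl : ∀ x : A, F xᶜ = E \ F x)
    (map_comp : ∀ x y : A, F (comp x y) = relComp (F x) (F y) ∩ E)
    (map_conv : ∀ x : A, F (conv x) = relInv (F x) ∩ E)
    (map_one : F one' = idRel' ∩ E) : IsWeaklyAssociative comp conv one' := by
  have map_top : F ⊤ = E := by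
    rw [← sup_compl_eq_top (x := (⊤ : A)), map_sup, map_compl]
    exact Set.union_sdiff_cancel (sub _)
  have map_inf (x y : A) : F (x ⊓ y) = F x ∩ F y := by
    rw [← compl_compl (x ⊓ y), compl_inf, map_compl, map_sup, map_compl, map_compl]
    ext p
    have := @sub x p
    simp only [Set.mem_sdiff, Set.mem_union, Set.mem_inter_iff]
    tauto
  refine ⟨fun x => inj ?_, fun x y z => inj ?_, fun x => inj ?_, fun x => inj ?_,
    fun x y => inj ?_, fun x y => inj ?_, fun x y => ?_⟩
  · ext ⟨u, v⟩
    simp only [map_comp, map_inf, map_one, map_top, relComp, idRel', Set.mem_inter_iff,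
      Set.mem_ofPred_eq]
    constructor
    · rintro ⟨⟨w, ⟨⟨z, ⟨hx, rfl, hz⟩, -⟩, -⟩, -⟩, huv⟩
      exact ⟨⟨u, ⟨hx, rfl, hz⟩, huv⟩, huv⟩
    · rintro ⟨hw, huv⟩
      exact ⟨⟨v, ⟨hw, huv⟩, (refl u v huv).2⟩, huv⟩
  · ext ⟨u, v⟩
    simp only [map_comp, map_sup, relComp, Set.mem_inter_iff, Set.mem_ofPred_eq, Set.mem_union,
      or_and_right, exists_or]
  · ext ⟨u, v⟩
    simp only [map_comp, map_one, relComp, idRel', Set.mem_inter_iff, Set.mem_ofPred_eq]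
    constructor
    · rintro ⟨⟨w, hx, rfl, -⟩, -⟩
      exact hx
    · intro hx
      exact ⟨⟨v, hx, rfl, (refl u v (sub x hx)).2⟩, sub x hx⟩
  · ext ⟨u, v⟩
    have := @sub x (u, v)
    have := symm u v
    simp only [map_conv, relInv, Set.mem_inter_iff, Set.mem_ofPred_eq]
    tauto
  · ext ⟨u, v⟩
    simp only [map_conv, map_sup, relInv, Set.mem_inter_iff, Set.mem_ofPred_eq, Set.mem_union]
    tauto
  · ext ⟨u, v⟩
    simp only [map_conv, map_comp, relComp, relInv, Set.mem_inter_iff, Set.mem_ofPred_eq]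
    constructor
    · rintro ⟨⟨⟨w, hx, hy⟩, -⟩, huv⟩
      exact ⟨⟨w, ⟨hy, symm _ _ (sub y hy)⟩, ⟨hx, symm _ _ (sub x hx)⟩⟩, huv⟩
    · rintro ⟨⟨w, ⟨hy, -⟩, ⟨hx, -⟩⟩, huv⟩
      exact ⟨⟨⟨w, hx, hy⟩, symm _ _ huv⟩, huv⟩
  · rw [← sup_eq_right]
    apply inj
    rw [map_sup, Set.union_eq_self_of_subset_left]
    rintro ⟨u, v⟩
    simp only [map_conv, map_comp, map_compl, relComp, relInv, Set.mem_inter_iff,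
      Set.mem_ofPred_eq, Set.mem_sdiff]
    rintro ⟨⟨w, ⟨hx, -⟩, hw, hn⟩, huv⟩
    exact ⟨huv, fun hy => hn ⟨⟨u, hx, hy⟩, hw⟩⟩

/-- Characterization of WA: an algebra `(A, +, ‾, ;, ⌣, 1')` whose Boolean
reduct is a Boolean algebra satisfies the WA axioms if and only if it embeds
into the relativization, to a symmetric-reflexive relation, of the algebra of
all binary relations on some set.  (`WA = S K`.) -/
theorem stmt_2 {A : Type u} [BooleanAlgebra A]
    (comp : A → A → A) (conv : A → A) (one' : A) :
    ((∀ x : A, comp (comp (x ⊓ one') ⊤) ⊤ = comp (x ⊓ one') ⊤) ∧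
     (∀ x y z : A, comp (x ⊔ y) z = comp x z ⊔ comp y z) ∧
     (∀ x : A, comp x one' = x) ∧
     (∀ x : A, conv (conv x) = x) ∧
     (∀ x y : A, conv (x ⊔ y) = conv x ⊔ conv y) ∧
     (∀ x y : A, conv (comp x y) = comp (conv y) (conv x)) ∧
     (∀ x y : A, comp (conv x) (comp x y)ᶜ ≤ yᶜ)) ↔
    (∃ (U : Type u) (E : Set (U × U)),
      (∀ u v : U, (u, v) ∈ E → (v, u) ∈ E) ∧
      (∀ u v : U, (u, v) ∈ E → (u, u) ∈ E ∧ (v, v) ∈ E) ∧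
      ∃ F : A → Set (U × U),
        Function.Injective F ∧
        (∀ x : A, F x ⊆ E) ∧
        (∀ x y : A, F (x ⊔ y) = F x ∪ F y) ∧
        (∀ x : A, F xᶜ = E \ F x) ∧
        (∀ x y : A, F (comp x y) = relComp (F x) (F y) ∩ E) ∧
        (∀ x : A, F (conv x) = relInv (F x) ∩ E) ∧
        F one' = idRel' ∩ E) := by
  constructor
  · rintro ⟨h₁, h₂, h₃, h₄, h₅, h₆, h₇⟩
    exact IsWeaklyAssociative.exists_representation ⟨h₁, h₂, h₃, h₄, h₅, h₆, h₇⟩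
  · rintro ⟨U, E, symm, refl, F, inj, sub, map_sup, map_compl, map_comp, map_conv, map_one⟩
    have h := isWeaklyAssociative_of_representation symm refl inj sub map_sup map_compl map_comp
      map_conv map_one
    exact ⟨h.weak_assoc, h.sup_comp, h.comp_one, h.conv_conv, h.conv_sup, h.conv_comp, h.tarski⟩
end

section
/- Let A be an atomic weakly associative relation algebra, let (U,T) be a labelling system for A, and let (u,a,v,b,c) be a flaw in (U,T). Then there is a labelling system (U',T') which extends (U,T) such that (u,a,v,b,c) is not a flaw in (U',T'). -/
universe u v

/-- A weakly associative relation algebra: a Boolean algebra equipped with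
relative multiplication `comp`, converse `conv`, and identity `one'`
satisfying the WA axioms. -/
structure WA (A : Type*) [BooleanAlgebra A] where
  comp : A → A → A
  conv : A → A
  one' : A
  wassoc : ∀ x : A, comp (comp (x ⊓ one') ⊤) ⊤ = comp (x ⊓ one') ⊤
  rdist : ∀ x y z : A, comp (x ⊔ y) z = comp x z ⊔ comp y z
  comp_one' : ∀ x : A, comp x one' = x
  conv_conv : ∀ x : A, conv (conv x) = x
  conv_sup : ∀ x y : A, conv (x ⊔ y) = conv x ⊔ conv y
  conv_comp : ∀ x y : A, conv (comp x y) = comp (conv y) (conv x)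
  tarski : ∀ x y : A, comp (conv x) (comp x y)ᶜ ≤ yᶜ

/-- A labelling system for a WA `W`: a set of labelled edges
`T ⊆ U × At(A) × U` satisfying conditions (i)--(v). -/
structure LabSys {A : Type*} [BooleanAlgebra A] (W : WA A) (U : Type*) where
  T : Set (U × A × U)
  mem_atom : ∀ ⦃u : U⦄ ⦃a : A⦄ ⦃v : U⦄, (u, a, v) ∈ T → IsAtom a
  functional : ∀ ⦃u : U⦄ ⦃a b : A⦄ ⦃v : U⦄, (u, a, v) ∈ T → (u, b, v) ∈ T → a = b
  ident_exists : ∀ a : A, IsAtom a → a ≤ W.one' → ∃ u : U, (u, a, u) ∈ T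
  ident_iff : ∀ u v : U, u = v ↔ ∃ a : A, IsAtom a ∧ a ≤ W.one' ∧ (u, a, v) ∈ T
  conv_mem : ∀ ⦃u : U⦄ ⦃a : A⦄ ⦃v : U⦄, (u, a, v) ∈ T → (v, W.conv a, u) ∈ T
  triangle : ∀ ⦃u : U⦄ ⦃a : A⦄ ⦃v : U⦄ ⦃b : A⦄ ⦃w : U⦄ ⦃c : A⦄,
    (u, a, v) ∈ T → (v, b, w) ∈ T → (u, c, w) ∈ T → c ≤ W.comp a b

/-- `(u,a,v,b,c)` is a flaw in the labelling system `L`. -/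
def Flaw {A : Type*} [BooleanAlgebra A] (W : WA A) {U : Type*} (L : LabSys W U)
    (u : U) (a : A) (v : U) (b c : A) : Prop :=
  IsAtom a ∧ IsAtom b ∧ IsAtom c ∧ (u, a, v) ∈ L.T ∧ a ≤ W.comp b c ∧
    ∀ w : U, (u, b, w) ∉ L.T ∨ (w, c, v) ∉ L.T

namespace WA

variable {A : Type*} [BooleanAlgebra A] (W : WA A)

lemma conv_mono {x y : A} (h : x ≤ y) : W.conv x ≤ W.conv y := by
  rw [← sup_eq_right] at h ⊢
  rw [← W.conv_sup, h]

lemma conv_le_iff {x y : A} : W.conv x ≤ y ↔ x ≤ W.conv y :=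
  ⟨fun h => by simpa [W.conv_conv] using W.conv_mono h,
    fun h => by simpa [W.conv_conv] using W.conv_mono h⟩

lemma conv_bot : W.conv ⊥ = ⊥ :=
  le_bot_iff.1 (W.conv_le_iff.2 bot_le)

lemma isAtom_conv {x : A} (h : IsAtom x) : IsAtom (W.conv x) := by
  refine ⟨fun h0 => h.1 ?_, fun y hy => ?_⟩
  · rw [← W.conv_conv x, h0, W.conv_bot]
  · have hlt : W.conv y < x := by
      refine lt_of_le_of_ne (W.conv_le_iff.2 hy.le) fun he => hy.ne ?_
      rw [← he, W.conv_conv]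
    rw [← W.conv_conv y, h.2 _ hlt, W.conv_bot]

lemma comp_mono_left {x y : A} (z : A) (h : x ≤ y) : W.comp x z ≤ W.comp y z := by
  rw [← sup_eq_right] at h ⊢
  rw [← W.rdist, h]

lemma comp_mono_right (x : A) {y z : A} (h : y ≤ z) : W.comp x y ≤ W.comp x z := by
  have := W.conv_mono (W.comp_mono_left (W.conv x) (W.conv_mono h))
  simpa [W.conv_comp, W.conv_conv] using this

lemma comp_mono {x y z t : A} (h : x ≤ y) (h' : z ≤ t) : W.comp x z ≤ W.comp y t :=
  (W.comp_mono_left z h).trans (W.comp_mono_right y h')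

lemma conv_one' : W.conv W.one' = W.one' := by
  have h : W.conv (W.comp (W.conv W.one') W.one') = W.comp (W.conv W.one') W.one' := by
    rw [W.conv_comp, W.conv_conv]
  rw [W.comp_one', W.conv_conv] at h
  exact h.symm

lemma one'_comp (x : A) : W.comp W.one' x = x := by
  rw [← W.conv_conv (W.comp W.one' x), W.conv_comp, W.conv_one', W.comp_one', W.conv_conv]

lemma conv_le_conv_comp {x y z : A} (h : z ≤ W.comp x y) :
    W.conv z ≤ W.comp (W.conv y) (W.conv x) := by
  rw [← W.conv_comp]
  exact W.conv_mono h

lemma comp_inf_ne_bot {x y z : A} (hz : z ≠ ⊥) (h : z ≤ W.comp x y) :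
    y ⊓ W.comp (W.conv x) z ≠ ⊥ := by
  intro h0
  have hy : y ≤ (W.comp (W.conv x) z)ᶜ := le_compl_iff_disjoint_right.2 (disjoint_iff.2 h0)
  have ht := W.tarski (W.conv x) z
  rw [W.conv_conv] at ht
  have hzz := (h.trans (W.comp_mono_right x hy)).trans ht
  exact hz (by simpa using le_compl_iff_disjoint_right.1 hzz)

lemma le_conv_comp {x y z : A} (hy : IsAtom y) (hz : IsAtom z) (h : z ≤ W.comp x y) :
    y ≤ W.comp (W.conv x) z :=
  hy.not_disjoint_iff_le.1 fun hd => W.comp_inf_ne_bot hz.1 h hd.eq_bot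

lemma le_comp_conv {x y z : A} (hx : IsAtom x) (hz : IsAtom z) (h : z ≤ W.comp x y) :
    x ≤ W.comp z (W.conv y) := by
  have := W.conv_le_conv_comp
    (W.le_conv_comp (W.isAtom_conv hx) (W.isAtom_conv hz) (W.conv_le_conv_comp h))
  simpa [W.conv_conv] using this

lemma conv_le_one' {e : A} (h : e ≤ W.one') : W.conv e ≤ W.one' :=
  W.conv_le_iff.2 (by rwa [W.conv_one'])

lemma eq_of_le_comp {e e' x : A} (he : IsAtom e) (he' : IsAtom e') (hi : e ≤ W.one')
    (hi' : e' ≤ W.one') (hx : x ≠ ⊥) (h : x ≤ W.comp e e') : e = e' := by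
  have h1 : x ≤ e := by simpa [W.comp_one'] using h.trans (W.comp_mono_right e hi')
  have h2 : x ≤ e' := by simpa [W.one'_comp] using h.trans (W.comp_mono_left e' hi)
  rw [← (he.le_iff.1 h1).resolve_left hx, ← (he'.le_iff.1 h2).resolve_left hx]

lemma comp_conv_ne_bot {x : A} (hx : x ≠ ⊥) : W.one' ⊓ W.comp x (W.conv x) ≠ ⊥ := by
  have hx' : W.conv x ≠ ⊥ := fun h => hx (by rw [← W.conv_conv x, h, W.conv_bot])
  simpa [W.conv_conv] using
    W.comp_inf_ne_bot (x := W.conv x) (y := W.one') hx' (by rw [W.comp_one'])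

lemma conv_eq_of_le_one' {e : A} (he : IsAtom e) (hi : e ≤ W.one') : W.conv e = e :=
  (W.eq_of_le_comp he (W.isAtom_conv he) hi (W.conv_le_one' hi)
    (fun h => W.comp_conv_ne_bot he.1 (by rw [h, inf_bot_eq])) le_rfl).symm

lemma le_comp_conv_self_of_le_one' {e : A} (he : IsAtom e) (hi : e ≤ W.one') :
    e ≤ W.comp e (W.conv e) := by
  have h0 := W.comp_conv_ne_bot he.1
  have h : W.comp e (W.conv e) ≤ e := by
    simpa [W.comp_one'] using W.comp_mono_right e (W.conv_le_one' hi)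
  rcases he.le_iff.1 h with h | h
  · exact absurd (by rw [h, inf_bot_eq]) h0
  · exact h.ge

lemma le_comp_self {e : A} (he : IsAtom e) (hi : e ≤ W.one') : e ≤ W.comp e e := by
  simpa [W.conv_eq_of_le_one' he hi] using W.le_comp_conv_self_of_le_one' he hi

/-- Every atom has an identity atom as its domain. -/
lemma exists_domain (hatomic : ∀ x : A, x ≠ ⊥ → ∃ a : A, IsAtom a ∧ a ≤ x) {x : A}
    (hx : IsAtom x) : ∃ e, IsAtom e ∧ e ≤ W.one' ∧ e ≤ W.comp x (W.conv x) := by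
  obtain ⟨e, he, h⟩ := hatomic _ (W.comp_conv_ne_bot hx.1)
  exact ⟨e, he, h.trans inf_le_left, h.trans inf_le_right⟩

/-- If `z ≤ x ; y`, then `z` and `x` have the same domain. -/
lemma domain_unique {e e' x y z : A} (he : IsAtom e) (he' : IsAtom e') (hi : e ≤ W.one')
    (hi' : e' ≤ W.one') (hx : IsAtom x) (h : z ≤ W.comp x y)
    (hez : e ≤ W.comp z (W.conv z)) (hex : e' ≤ W.comp x (W.conv x)) : e = e' := by
  have hw : W.comp (W.comp e' ⊤) ⊤ = W.comp e' ⊤ := by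
    simpa [inf_eq_left.2 hi'] using W.wassoc e'
  have hx' : x ≤ W.comp e' ⊤ := by
    have := W.le_comp_conv hx he' hex
    exact this.trans (W.comp_mono_right _ le_top)
  have hz : z ≤ W.comp e' ⊤ := hw ▸ h.trans (W.comp_mono hx' le_top)
  have hee : e ≤ W.comp e' ⊤ := hw ▸ hez.trans (W.comp_mono hz le_top)
  have hne := W.comp_inf_ne_bot he.1 hee
  rw [top_inf_eq, W.conv_eq_of_le_one' he' hi'] at hne
  exact (W.eq_of_le_comp he' he hi' hi hne le_rfl).symm

end WA

namespace LabSys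

variable {A : Type*} [BooleanAlgebra A] {W : WA A} {U : Type*}

lemma exists_loop (L : LabSys W U) (p : U) :
    ∃ e, IsAtom e ∧ e ≤ W.one' ∧ (p, e, p) ∈ L.T :=
  (L.ident_iff p p).1 rfl

lemma le_one'_of_loop (L : LabSys W U) {p : U} {e : A} (h : (p, e, p) ∈ L.T) :
    e ≤ W.one' := by
  obtain ⟨e', -, hi, h'⟩ := L.exists_loop p
  exact L.functional h h' ▸ hi

lemma loop_le_comp_conv (L : LabSys W U) {p q : U} {e x : A} (he : (p, e, p) ∈ L.T)
    (hx : (p, x, q) ∈ L.T) : e ≤ W.comp x (W.conv x) :=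
  L.triangle hx (L.conv_mem hx) he

lemma loop_eq_domain (L : LabSys W U) {p q : U} {e e' x y z : A} (he : (p, e, p) ∈ L.T)
    (hz : (p, z, q) ∈ L.T) (hx : IsAtom x) (h : z ≤ W.comp x y) (he' : IsAtom e')
    (hi' : e' ≤ W.one') (hex : e' ≤ W.comp x (W.conv x)) : e = e' :=
  W.domain_unique (L.mem_atom he) he' (L.le_one'_of_loop he) hi' hx h
    (L.loop_le_comp_conv he hz) hex

/-- The membership relation of the extension of a labelling system by one point `none`, where
`N p x` says that the edge from `p` to the new point is labelled `x`, and the loop at the new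
point is labelled `f`. -/
def adjoinRel (L : LabSys W U) (N : U → A → Prop) (f : A) : Option U → A → Option U → Prop
  | some p, x, some q => (p, x, q) ∈ L.T
  | some p, x, none => N p x
  | none, x, some q => N q (W.conv x)
  | none, x, none => x = f

/-- The extension of a labelling system by one point `none`. -/
def adjoin (L : LabSys W U) (N : U → A → Prop) (f : A) (hf : IsAtom f) (hfi : f ≤ W.one')
    (hatom : ∀ p x, N p x → IsAtom x) (hne : ∀ p x, N p x → ¬ x ≤ W.one')
    (hfun : ∀ p x y, N p x → N p y → x = y)
    (hloop : ∀ p x, N p x → f ≤ W.comp (W.conv x) x)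
    (htri : ∀ p q x y z, N p x → N q y → (p, z, q) ∈ L.T → z ≤ W.comp x (W.conv y)) :
    LabSys W (Option U) where
  T := {t | L.adjoinRel N f t.1 t.2.1 t.2.2}
  mem_atom := by
    rintro (_ | p) x (_ | q) h
    · have hx : x = f := h
      rwa [hx]
    · simpa [W.conv_conv] using W.isAtom_conv (hatom _ _ h)
    · exact hatom _ _ h
    · exact L.mem_atom h
  functional := by
    rintro (_ | p) x y (_ | q) h h'
    · exact Eq.trans h (Eq.symm h')
    · rw [← W.conv_conv x, hfun _ _ _ h h', W.conv_conv]
    · exact hfun _ _ _ h h'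
    · exact L.functional h h'
  ident_exists e he hi := by
    obtain ⟨p, hp⟩ := L.ident_exists e he hi
    exact ⟨some p, hp⟩
  ident_iff := by
    rintro (_ | p) (_ | q)
    · exact iff_of_true rfl ⟨f, hf, hfi, rfl⟩
    · exact iff_of_false (by simp) fun ⟨x, _, hi, h⟩ => hne _ _ h (W.conv_le_one' hi)
    · exact iff_of_false (by simp) fun ⟨x, _, hi, h⟩ => hne _ _ h hi
    · rw [Option.some_inj]
      exact L.ident_iff p q
  conv_mem := by
    rintro (_ | p) x (_ | q) h
    · have hx : x = f := h
      rw [hx]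
      exact W.conv_eq_of_le_one' hf hfi
    · exact h
    · change N p (W.conv (W.conv x))
      rwa [W.conv_conv]
    · exact L.conv_mem h
  triangle := by
    rintro (_ | p) x (_ | q) y (_ | r) z h1 h2 h3
    · have hx : x = f := h1
      have hy : y = f := h2
      have hz : z = f := h3
      rw [hx, hy, hz]
      exact W.le_comp_self hf hfi
    · have hx : x = f := h1
      have hyz : y = z := by rw [← W.conv_conv y, hfun _ _ _ h2 h3, W.conv_conv]
      have hy := W.isAtom_conv (hatom _ _ h2)
      have h := hloop _ _ h2
      rw [W.conv_conv] at h hy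
      rw [hx, ← hyz]
      simpa [W.conv_conv] using W.le_comp_conv hy hf h
    · have hz : z = f := h3
      have hxy : y = W.conv x := hfun _ _ _ h2 h1
      have h := hloop _ _ h1
      rw [W.conv_conv] at h
      rw [hz, hxy]
      exact h
    · have hz := W.isAtom_conv (hatom _ _ h3)
      have h := htri _ _ _ _ _ h1 h3 h2
      rw [W.conv_conv] at h hz
      simpa [W.conv_conv] using W.le_conv_comp hz (L.mem_atom h2) h
    · have hy : y = f := h2
      have hxz : x = z := hfun _ _ _ h1 h3
      have h := W.le_conv_comp (hatom _ _ h1) hf (hloop _ _ h1)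
      rw [hy, ← hxz]
      simpa [W.conv_conv] using h
    · simpa [W.conv_conv] using htri _ _ _ _ _ h1 h2 h3
    · have h := W.le_comp_conv (hatom _ _ h3) (L.mem_atom h1) (htri _ _ _ _ _ h3 h2 h1)
      simpa [W.conv_conv] using h
    · exact L.triangle h1 h2 h3

/-- Transport of a labelling system along an equivalence. -/
def transport {V : Type*} (L : LabSys W U) (g : V ≃ U) : LabSys W V where
  T := {t | (g t.1, t.2.1, g t.2.2) ∈ L.T}
  mem_atom _ _ _ h := L.mem_atom h
  functional _ _ _ _ h h' := L.functional h h'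
  ident_exists e he hi := by
    obtain ⟨p, hp⟩ := L.ident_exists e he hi
    exact ⟨g.symm p, by simpa using hp⟩
  ident_iff p q := by
    rw [← g.injective.eq_iff]
    exact L.ident_iff (g p) (g q)
  conv_mem _ _ _ h := L.conv_mem h
  triangle _ _ _ _ _ _ h1 h2 h3 := L.triangle h1 h2 h3

end LabSys

section Flaw

variable {A : Type*} [BooleanAlgebra A] {W : WA A} {U : Type*} {L : LabSys W U}
  {u v : U} {a b c : A}

lemma Flaw.conv (h : Flaw W L u a v b c) :
    Flaw W L v (W.conv a) u (W.conv c) (W.conv b) := by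
  obtain ⟨ha, hb, hc, hT, hle, hno⟩ := h
  refine ⟨W.isAtom_conv ha, W.isAtom_conv hc, W.isAtom_conv hb, L.conv_mem hT,
    W.conv_le_conv_comp hle, fun w => ?_⟩
  refine (hno w).symm.imp (fun h h' => h ?_) (fun h h' => h ?_)
  · simpa [W.conv_conv] using L.conv_mem h'
  · simpa [W.conv_conv] using L.conv_mem h'

lemma Flaw.not_le_one' (h : Flaw W L u a v b c) : ¬ b ≤ W.one' := by
  obtain ⟨ha, hb, hc, hT, hle, hno⟩ := h
  intro hi
  have hac : a ≤ c := by simpa [W.one'_comp] using hle.trans (W.comp_mono_left c hi)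
  obtain rfl : a = c := (hc.le_iff.1 hac).resolve_left ha.1
  obtain ⟨e, -, -, heT⟩ := L.exists_loop u
  obtain rfl := L.loop_eq_domain heT hT hb hle hb hi (W.le_comp_conv_self_of_le_one' hb hi)
  exact (hno u).elim (fun h => h heT) (fun h => h hT)

lemma Flaw.eq_conv (h : Flaw W L u a u b c) : c = W.conv b := by
  obtain ⟨ha, hb, hc, hT, hle, -⟩ := h
  have h1 := (W.le_conv_comp hc ha hle).trans
    (W.comp_mono_right _ (L.le_one'_of_loop hT))
  rw [W.comp_one'] at h1
  exact ((W.isAtom_conv hb).le_iff.1 h1).resolve_left hc.1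

lemma Flaw.loop_le (hatomic : ∀ x : A, x ≠ ⊥ → ∃ a : A, IsAtom a ∧ a ≤ x)
    (h : Flaw W L u a v b c) {e : A} (he : (u, e, u) ∈ L.T) : e ≤ W.comp b (W.conv b) := by
  obtain ⟨-, hb, -, hT, hle, -⟩ := h
  obtain ⟨d, hd, hdi, hdb⟩ := W.exists_domain hatomic hb
  obtain rfl := L.loop_eq_domain he hT hb hle hd hdi hdb
  exact hdb

lemma Flaw.exists_adjoin (hatomic : ∀ x : A, x ≠ ⊥ → ∃ a : A, IsAtom a ∧ a ≤ x)
    (h : Flaw W L u a v b c) :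
    ∃ L' : LabSys W (Option U),
      (∀ p x q, (p, x, q) ∈ L.T → (some p, x, some q) ∈ L'.T) ∧
      (some u, b, none) ∈ L'.T ∧ (none, c, some v) ∈ L'.T := by
  have hflaw := h
  obtain ⟨ha, hb, hc, hT, hle, -⟩ := h
  obtain ⟨f, hf, hfi, hfc⟩ := W.exists_domain hatomic hc
  have hfb : f ≤ W.comp (W.conv b) b := by
    obtain ⟨d, hd, hdi, hdb⟩ := W.exists_domain hatomic (W.isAtom_conv hb)
    obtain rfl := W.domain_unique hf hd hfi hdi (W.isAtom_conv hb)
      (W.le_conv_comp hc ha hle) hfc hdb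
    simpa [W.conv_conv] using hdb
  refine ⟨L.adjoin (fun p x => (p = u ∧ x = b) ∨ (p = v ∧ x = W.conv c)) f hf hfi
    ?_ ?_ ?_ ?_ ?_, fun _ _ _ hp => hp, Or.inl ⟨rfl, rfl⟩, Or.inr ⟨rfl, rfl⟩⟩
  · rintro p x (⟨-, rfl⟩ | ⟨-, rfl⟩)
    exacts [hb, W.isAtom_conv hc]
  · rintro p x (⟨-, rfl⟩ | ⟨-, rfl⟩)
    exacts [hflaw.not_le_one', hflaw.conv.not_le_one']
  · rintro p x y (⟨rfl, rfl⟩ | ⟨rfl, rfl⟩) (⟨hp, rfl⟩ | ⟨hp, rfl⟩)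
    · rfl
    · subst hp
      rw [hflaw.eq_conv, W.conv_conv]
    · subst hp
      rw [hflaw.eq_conv, W.conv_conv]
    · rfl
  · rintro p x (⟨-, rfl⟩ | ⟨-, rfl⟩)
    · exact hfb
    · rwa [W.conv_conv]
  · rintro p q x y z (⟨rfl, rfl⟩ | ⟨rfl, rfl⟩) (⟨rfl, rfl⟩ | ⟨rfl, rfl⟩) hz
    · exact hflaw.loop_le hatomic hz
    · rw [W.conv_conv, L.functional hz hT]
      exact hle
    · rw [L.functional hz (L.conv_mem hT)]
      exact W.conv_le_conv_comp hle
    · exact hflaw.conv.loop_le hatomic hz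

end Flaw

/-- Lemma A: a flaw in a labelling system can be repaired in an extension. -/
theorem stmt_3 {A : Type u} [BooleanAlgebra A] (W : WA A)
    (hatomic : ∀ x : A, x ≠ ⊥ → ∃ a : A, IsAtom a ∧ a ≤ x)
    {U : Type v} (L : LabSys W U) (u v : U) (a b c : A)
    (hflaw : Flaw W L u a v b c) :
    ∃ (U' : Type (max u v)) (i : U ↪ U') (L' : LabSys W U'),
      (∀ (p : U) (x : A) (q : U), (p, x, q) ∈ L.T → (i p, x, i q) ∈ L'.T) ∧
      ¬ Flaw W L' (i u) a (i v) b c := by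
  obtain ⟨L', hext, hb, hc⟩ := hflaw.exists_adjoin hatomic
  refine ⟨ULift.{u, v} (Option U), Function.Embedding.some.trans Equiv.ulift.symm.toEmbedding,
    L'.transport Equiv.ulift, fun p x q h => hext p x q h, ?_⟩
  rintro ⟨-, -, -, -, -, hno⟩
  exact (hno ⟨none⟩).elim (fun h => h hb) (fun h => h hc)
end
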